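/- The Lie derivative of ω along q vanishes: L_q ω = 0, where ω = 𝒱_{abc}(ξ) dξ^a ∧ dρ^{bc} and q is the Chevalley-Eilenberg vector field of the (A)dS/Poincaré algebra. -/

import Mathlib

open scoped BigOperators

noncomputable def eps {n : ℕ} (g : Fin n → Fin n) : ℝ :=
  ∑ σ : Equiv.Perm (Fin n),
    if (σ : Fin n → Fin n) = g then ((Equiv.Perm.sign σ : ℤ) : ℝ) else 0

def cat3 {n : ℕ} (a b c : Fin n) (f : Fin (n - 3) → Fin n) : Fin n → Fin n :=
  fun i =>
    if i.val = 0 then a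
    else if i.val = 1 then b
    else if i.val = 2 then c
    else if h : i.val - 3 < n - 3 then f ⟨i.val - 3, h⟩ else a

def cat2 {n : ℕ} (a b : Fin n) (f : Fin (n - 2) → Fin n) : Fin n → Fin n :=
  fun i =>
    if i.val = 0 then a
    else if i.val = 1 then b
    else if h : i.val - 2 < n - 2 then f ⟨i.val - 2, h⟩ else a

noncomputable def Vthree {n : ℕ} {A : Type*} [Ring A] [Algebra ℝ A]
    (ξ : Fin n → A) (a b c : Fin n) : A :=
  ((Nat.factorial (n - 3) : ℝ))⁻¹ •
    ∑ f : Fin (n - 3) → Fin n,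
      eps (cat3 a b c f) • (List.ofFn fun j => ξ (f j)).prod

noncomputable def Vtwo {n : ℕ} {A : Type*} [Ring A] [Algebra ℝ A]
    (ξ : Fin n → A) (a b : Fin n) : A :=
  ((Nat.factorial (n - 2) : ℝ))⁻¹ •
    ∑ f : Fin (n - 2) → Fin n,
      eps (cat2 a b f) • (List.ofFn fun j => ξ (f j)).prod

/-- ordered product of odd coordinates -/
def Pmon {N m : ℕ} {A : Type*} [Ring A] (ξ : Fin N → A) (f : Fin m → Fin N) : A :=
  (List.ofFn fun j => ξ (f j)).prod

theorem Pmon_zero {N : ℕ} {A : Type*} [Ring A] (ξ : Fin N → A) (f : Fin 0 → Fin N) :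
    Pmon ξ f = 1 := by
  simp [Pmon]

theorem Pmon_cons {N m : ℕ} {A : Type*} [Ring A] (ξ : Fin N → A) (a : Fin N)
    (f : Fin m → Fin N) :
    Pmon ξ (Fin.cons a f : Fin (m + 1) → Fin N) = ξ a * Pmon ξ f := by
  simp [Pmon, List.ofFn_succ]

theorem sum_cons {N m : ℕ} {M : Type*} [AddCommMonoid M] (F : (Fin (m + 1) → Fin N) → M) :
    ∑ f, F f = ∑ a, ∑ f : Fin m → Fin N, F (Fin.cons a f) := by
  rw [← (Fin.consEquiv (fun _ : Fin (m+1) => Fin N)).sum_comp, Fintype.sum_prod_type]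
  rfl

theorem sum_insertNth {N m : ℕ} {M : Type*} [AddCommMonoid M] (j : Fin (m + 1))
    (F : (Fin (m + 1) → Fin N) → M) :
    ∑ f, F f = ∑ a, ∑ f : Fin m → Fin N, F (j.insertNth a f) := by
  rw [← (Fin.insertNthEquiv (fun _ : Fin (m+1) => Fin N) j).sum_comp, Fintype.sum_prod_type]
  rfl

theorem Pmon_mul_xi {N m : ℕ} {A : Type*} [Ring A] [Algebra ℝ A] (ξ : Fin N → A)
    (hξξ : ∀ a b, ξ a * ξ b = - (ξ b * ξ a)) (e : Fin N) (f : Fin m → Fin N) :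
    Pmon ξ f * ξ e = ((-1 : ℝ) ^ m) • (ξ e * Pmon ξ f) := by
  induction m with
  | zero => simp [Pmon_zero]
  | succ m ih =>
    rw [← Fin.cons_self_tail f, Pmon_cons, mul_assoc, ih, mul_smul_comm, ← mul_assoc,
      hξξ (f 0) e, pow_succ]
    simp [mul_assoc]

theorem Pmon_insertNth {N m : ℕ} {A : Type*} [Ring A] [Algebra ℝ A] (ξ : Fin N → A)
    (hξξ : ∀ a b, ξ a * ξ b = - (ξ b * ξ a)) (j : Fin (m + 1)) (e : Fin N)
    (f : Fin m → Fin N) :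
    Pmon ξ (j.insertNth e f : Fin (m + 1) → Fin N) = ((-1 : ℝ) ^ (j : ℕ)) • (ξ e * Pmon ξ f) := by
  induction m with
  | zero =>
    obtain rfl : j = 0 := Fin.fin_one_eq_zero j
    simp [Fin.insertNth_zero', Pmon_cons]
  | succ m ih =>
    refine Fin.cases ?_ (fun i => ?_) j
    · simp [Fin.insertNth_zero', Pmon_cons]
    · have h : ((i.succ).insertNth e f : Fin (m + 2) → Fin N)
          = Fin.cons (f 0) (i.insertNth e (Fin.tail f)) := by
        rw [Fin.insertNth_eq_iff]
        refine ⟨by simp, ?_⟩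
        funext x
        refine Fin.cases ?_ (fun y => ?_) x
        · simp [Fin.removeNth]
        · simp [Fin.removeNth, Fin.tail]
      rw [h, Pmon_cons, ih]
      conv_rhs => rw [← Fin.cons_self_tail f, Pmon_cons]
      rw [mul_smul_comm, ← mul_assoc, ← mul_assoc, hξξ (f 0) e, Fin.val_succ, pow_succ]
      simp

theorem eps_eq_det {n : ℕ} (g : Fin n → Fin n) :
    eps g = Matrix.det (Matrix.of fun i j => if g i = j then (1 : ℝ) else 0) := by
  rw [← Matrix.det_transpose, Matrix.det_apply', eps]
  refine Finset.sum_congr rfl fun σ _ => ?_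
  by_cases h : (σ : Fin n → Fin n) = g
  · simp [h.symm]
  · rw [if_neg h]
    obtain ⟨i, hi⟩ := Function.ne_iff.mp h
    rw [Finset.prod_eq_zero (Finset.mem_univ i), mul_zero]
    simp [Ne.symm hi]

theorem eps_swap {n : ℕ} (g : Fin n → Fin n) (i j : Fin n) (hij : i ≠ j) :
    eps (g ∘ Equiv.swap i j) = - eps g := by
  rw [eps_eq_det, eps_eq_det]
  have := Matrix.det_permute (Equiv.swap i j)
    (Matrix.of fun i j => if g i = j then (1 : ℝ) else 0)
  rw [Equiv.Perm.sign_swap hij] at this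
  simpa [Matrix.submatrix] using this

theorem eps_over {n : ℕ} (e : Fin n) (h : Fin (n + 1) → Fin n) :
    ∑ i : Fin (n + 1), (-1 : ℝ) ^ (i : ℕ) * (if h i = e then (1 : ℝ) else 0)
      * eps (h ∘ i.succAbove) = 0 := by
  set M : Matrix (Fin (n + 1)) (Fin (n + 1)) ℝ :=
    Matrix.of fun i j => (Fin.cons (if h i = e then (1 : ℝ) else 0)
      (fun j => if h i = j then (1 : ℝ) else 0) : Fin (n + 1) → ℝ) j with hM
  have h0 : M.det = 0 := by
    refine Matrix.det_zero_of_column_eq (i := 0) (j := e.succ) (Fin.succ_ne_zero e).symm ?_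
    intro k
    simp [hM]
  rw [Matrix.det_succ_column_zero] at h0
  refine Eq.trans (Finset.sum_congr rfl fun i _ => ?_) h0
  rw [eps_eq_det]
  rfl

theorem cat3_eq {k : ℕ} (a b c : Fin (k + 3)) (f : Fin k → Fin (k + 3)) :
    cat3 a b c f = Fin.cons a (Fin.cons b (Fin.cons c f)) := by
  funext i
  refine Fin.cases ?_ (fun i => ?_) i
  · simp [cat3]
  refine Fin.cases ?_ (fun i => ?_) i
  · simp [cat3]
  refine Fin.cases ?_ (fun i => ?_) i
  · rfl
  · simp [cat3]

theorem cat2_eq {k : ℕ} (a b : Fin (k + 3)) (f : Fin (k + 1) → Fin (k + 3)) :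
    cat2 a b f = Fin.cons a (Fin.cons b f) := by
  funext i
  refine Fin.cases ?_ (fun i => ?_) i
  · simp [cat2]
  refine Fin.cases ?_ (fun i => ?_) i
  · simp [cat2]
  · simp [cat2]
    intro h
    omega

theorem Vthree_eq {k : ℕ} {A : Type*} [Ring A] [Algebra ℝ A]
    (ξ : Fin (k + 3) → A) (a b c : Fin (k + 3)) :
    Vthree ξ a b c = ((Nat.factorial k : ℝ))⁻¹ • ∑ f : Fin k → Fin (k + 3),
      eps (Fin.cons a (Fin.cons b (Fin.cons c f))) • Pmon ξ f := by
  simp only [← cat3_eq]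
  rfl

theorem Vtwo_eq {k : ℕ} {A : Type*} [Ring A] [Algebra ℝ A]
    (ξ : Fin (k + 3) → A) (a b : Fin (k + 3)) :
    Vtwo ξ a b = ((Nat.factorial (k + 1) : ℝ))⁻¹ • ∑ f : Fin (k + 1) → Fin (k + 3),
      eps (Fin.cons a (Fin.cons b f)) • Pmon ξ f := by
  simp only [← cat2_eq]
  rfl

theorem cons_swap01 {N m : ℕ} (a b : Fin N) (f : Fin m → Fin N) :
    (Fin.cons b (Fin.cons a f) : Fin (m + 2) → Fin N) ∘ Equiv.swap 0 1
      = Fin.cons a (Fin.cons b f) := by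
  funext i
  refine Fin.cases ?_ (fun i => ?_) i
  · simp
  refine Fin.cases ?_ (fun i => ?_) i
  · have : (Fin.succ 0 : Fin (m + 2)) = 1 := rfl
    simp [this]
  · have h1 : (i.succ.succ : Fin (m + 2)) ≠ 0 := Fin.succ_ne_zero _
    have h2 : (i.succ.succ : Fin (m + 2)) ≠ 1 := by
      intro h; simp [Fin.ext_iff] at h
    simp [Equiv.swap_apply_of_ne_of_ne h1 h2]

theorem cons_comp_swap {N m : ℕ} (a : Fin N) (f : Fin m → Fin N) (i j : Fin m) :
    (Fin.cons a f : Fin (m + 1) → Fin N) ∘ Equiv.swap i.succ j.succ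
      = Fin.cons a (f ∘ Equiv.swap i j) := by
  funext y
  refine Fin.cases ?_ (fun y => ?_) y
  · rw [Function.comp, Equiv.swap_apply_of_ne_of_ne (Fin.succ_ne_zero _).symm
      (Fin.succ_ne_zero _).symm]
    simp
  · have : Equiv.swap i.succ j.succ y.succ = (Equiv.swap i j y).succ :=
      (Fin.succ_injective _).swap_apply i j y
    simp [Function.comp, this]

theorem eps_cons_swap01 {k : ℕ} (a b : Fin (k + 2)) (f : Fin k → Fin (k + 2)) :
    eps (Fin.cons a (Fin.cons b f)) = - eps (Fin.cons b (Fin.cons a f)) := by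
  rw [← eps_swap _ 0 1 (by simp), cons_swap01]

theorem eps_cons_swap12 {k : ℕ} (a b c : Fin (k + 3)) (f : Fin k → Fin (k + 3)) :
    eps (Fin.cons a (Fin.cons b (Fin.cons c f)))
      = - eps (Fin.cons a (Fin.cons c (Fin.cons b f))) := by
  rw [← eps_swap _ (Fin.succ 0) (Fin.succ 1) (by rw [Ne, Fin.succ_inj]; simp), cons_comp_swap,
    cons_swap01]

theorem Vthree_swap01 {k : ℕ} {A : Type*} [Ring A] [Algebra ℝ A]
    (ξ : Fin (k + 3) → A) (a b c : Fin (k + 3)) : Vthree ξ a b c = - Vthree ξ b a c := by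
  rw [Vthree_eq, Vthree_eq, ← smul_neg, ← Finset.sum_neg_distrib]
  congr 1
  refine Finset.sum_congr rfl fun f _ => ?_
  rw [eps_cons_swap01, neg_smul]

theorem Vthree_swap12 {k : ℕ} {A : Type*} [Ring A] [Algebra ℝ A]
    (ξ : Fin (k + 3) → A) (a b c : Fin (k + 3)) : Vthree ξ a b c = - Vthree ξ a c b := by
  rw [Vthree_eq, Vthree_eq, ← smul_neg, ← Finset.sum_neg_distrib]
  congr 1
  refine Finset.sum_congr rfl fun f _ => ?_
  rw [eps_cons_swap12, neg_smul]

theorem Vtwo_swap {k : ℕ} {A : Type*} [Ring A] [Algebra ℝ A]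
    (ξ : Fin (k + 3) → A) (a b : Fin (k + 3)) : Vtwo ξ a b = - Vtwo ξ b a := by
  rw [Vtwo_eq, Vtwo_eq, ← smul_neg, ← Finset.sum_neg_distrib]
  congr 1
  refine Finset.sum_congr rfl fun f _ => ?_
  rw [eps_cons_swap01, neg_smul]

theorem Vthree_mul_xi {k : ℕ} {A : Type*} [Ring A] [Algebra ℝ A] (ξ : Fin (k + 3) → A)
    (hξξ : ∀ a b, ξ a * ξ b = - (ξ b * ξ a)) (a b c e : Fin (k + 3)) :
    Vthree ξ a b c * ξ e = ((-1 : ℝ) ^ k) • (ξ e * Vthree ξ a b c) := by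
  rw [Vthree_eq, smul_mul_assoc, mul_smul_comm, smul_comm]
  congr 1
  rw [Finset.sum_mul, Finset.mul_sum, Finset.smul_sum]
  refine Finset.sum_congr rfl fun f _ => ?_
  rw [smul_mul_assoc, mul_smul_comm, Pmon_mul_xi ξ hξξ, smul_comm]

theorem eps_over3 {k : ℕ} (e a b c : Fin (k + 3)) (f : Fin (k + 1) → Fin (k + 3)) :
    (if a = e then (1 : ℝ) else 0) * eps (Fin.cons b (Fin.cons c f))
      - (if b = e then (1 : ℝ) else 0) * eps (Fin.cons a (Fin.cons c f))
      + (if c = e then (1 : ℝ) else 0) * eps (Fin.cons a (Fin.cons b f))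
      = ∑ j : Fin (k + 1), (-1 : ℝ) ^ (j : ℕ) * (if f j = e then (1 : ℝ) else 0)
        * eps (Fin.cons a (Fin.cons b (Fin.cons c (f ∘ j.succAbove)))) := by
  have h := eps_over e (Fin.cons a (Fin.cons b (Fin.cons c f)) : Fin (k + 4) → Fin (k + 3))
  have key : ∀ {m : ℕ} (x : Fin (k + 3)) (g : Fin (m + 1) → Fin (k + 3)) (i : Fin (m + 1)),
      (Fin.cons x g : Fin (m + 2) → Fin (k + 3)) ∘ i.succ.succAbove
        = Fin.cons x (g ∘ i.succAbove) := by
    intro m x g i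
    funext y
    refine Fin.cases ?_ (fun y => ?_) y
    · simp
    · simp
  have key0 : ∀ {m : ℕ} (x : Fin (k + 3)) (g : Fin m → Fin (k + 3)),
      (Fin.cons x g : Fin (m + 1) → Fin (k + 3)) ∘ (Fin.succAbove 0) = g := by
    intro m x g
    funext y
    simp
  rw [Fin.sum_univ_succ (n := k + 3), Fin.sum_univ_succ (n := k + 2),
    Fin.sum_univ_succ (n := k + 1)] at h
  simp only [key, key0, Fin.cons_zero, Fin.cons_succ, Fin.val_succ, Fin.val_zero, pow_succ,
    pow_zero, one_mul, mul_neg, mul_one, neg_neg, neg_mul, Finset.sum_neg_distrib] at h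
  linarith

theorem xi_mul_Vthree {k : ℕ} {A : Type*} [Ring A] [Algebra ℝ A] (ξ : Fin (k + 3) → A)
    (hξξ : ∀ a b, ξ a * ξ b = - (ξ b * ξ a)) (a b c e : Fin (k + 3)) :
    ξ e * Vthree ξ a b c = (if a = e then (1 : ℝ) else 0) • Vtwo ξ b c
      - (if b = e then (1 : ℝ) else 0) • Vtwo ξ a c
      + (if c = e then (1 : ℝ) else 0) • Vtwo ξ a b := by
  have h1 : ∑ f : Fin (k + 1) → Fin (k + 3),
      (∑ j : Fin (k + 1), (-1 : ℝ) ^ (j : ℕ) * (if f j = e then (1 : ℝ) else 0)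
        * eps (Fin.cons a (Fin.cons b (Fin.cons c (f ∘ j.succAbove))))) • Pmon ξ f
      = ((k : ℝ) + 1) • ∑ f : Fin k → Fin (k + 3),
        eps (Fin.cons a (Fin.cons b (Fin.cons c f))) • (ξ e * Pmon ξ f) := by
    simp only [Finset.sum_smul]
    rw [Finset.sum_comm]
    have : ∀ j : Fin (k + 1), ∑ f : Fin (k + 1) → Fin (k + 3),
      ((-1 : ℝ) ^ (j : ℕ) * (if f j = e then (1 : ℝ) else 0)
        * eps (Fin.cons a (Fin.cons b (Fin.cons c (f ∘ j.succAbove))))) • Pmon ξ f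
      = ∑ f : Fin k → Fin (k + 3),
        eps (Fin.cons a (Fin.cons b (Fin.cons c f))) • (ξ e * Pmon ξ f) := by
      intro j
      rw [sum_insertNth j, Finset.sum_eq_single e]
      · refine Finset.sum_congr rfl fun f _ => ?_
        have hc : (j.insertNth e f : Fin (k + 1) → Fin (k + 3)) ∘ j.succAbove = f := by
          funext y; simp
        rw [hc, Pmon_insertNth ξ hξξ, smul_smul]
        congr 1
        have : (-1 : ℝ) ^ (j : ℕ) * (-1 : ℝ) ^ (j : ℕ) = 1 := by
          rw [← mul_pow]; simp
        simp only [Fin.insertNth_apply_same, if_true]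
        linear_combination (eps (Fin.cons a (Fin.cons b (Fin.cons c f)))) * this
      · intro x _ hx
        refine Finset.sum_eq_zero fun f _ => ?_
        simp [hx]
      · simp
    simp only [this]
    simp only [Finset.sum_const, Finset.card_univ, Fintype.card_fin]
    rw [← Nat.cast_smul_eq_nsmul ℝ]
    push_cast
    rfl
  simp only [← eps_over3] at h1
  rw [Vtwo_eq, Vtwo_eq, Vtwo_eq, Vthree_eq, mul_smul_comm, Finset.mul_sum]
  simp only [mul_smul_comm]
  have hk : ((Nat.factorial k : ℝ))⁻¹ = ((Nat.factorial (k + 1) : ℝ))⁻¹ * ((k : ℝ) + 1) := by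
    have h1 : (Nat.factorial k : ℝ) ≠ 0 := by exact_mod_cast Nat.factorial_ne_zero k
    have h2 : (k : ℝ) + 1 ≠ 0 := by positivity
    rw [Nat.factorial_succ]
    push_cast
    field_simp
  rw [hk, mul_smul, ← h1]
  simp only [sub_smul, add_smul, mul_smul, Finset.sum_add_distrib, Finset.sum_sub_distrib,
    smul_add, smul_sub, Finset.smul_sum]
  congr 1
  · congr 1
    · refine Finset.sum_congr rfl fun f _ => ?_
      rw [smul_comm]
    · refine Finset.sum_congr rfl fun f _ => ?_
      rw [smul_comm]
  · refine Finset.sum_congr rfl fun f _ => ?_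
    rw [smul_comm]

theorem d_sum_Pmon {N : ℕ} {A : Type*} [Ring A] [Algebra ℝ A] (ξ Dξ : Fin N → A)
    (hDξc : ∀ a x, Dξ a * x = x * Dξ a) (d : A →ₗ[ℝ] A)
    (hdLξ : ∀ a x, d (ξ a * x) = Dξ a * x - ξ a * d x) (x : A) (m : ℕ)
    (T : (Fin (m + 1) → Fin N) → ℝ)
    (hT : ∀ f (i j : Fin (m + 1)), i ≠ j → T (f ∘ Equiv.swap i j) = - T f) :
    ∑ f, T f • d (Pmon ξ f * x)
      = ((m : ℝ) + 1) • (∑ a, ∑ f : Fin m → Fin N, T (Fin.cons a f) • (Pmon ξ f * (Dξ a * x)))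
        + ((-1 : ℝ) ^ (m + 1)) • ∑ f, T f • (Pmon ξ f * d x) := by
  induction m with
  | zero =>
    rw [sum_cons, sum_cons]
    simp [Pmon_cons, Pmon_zero, hdLξ, smul_sub, sub_eq_add_neg, Finset.sum_add_distrib]
  | succ m ih =>
    have hTa : ∀ a, ∀ f (i j : Fin (m + 1)), i ≠ j →
        T (Fin.cons a (f ∘ Equiv.swap i j)) = - T (Fin.cons a f) := by
      intro a f i j hij
      rw [← hT _ i.succ j.succ (by simpa using hij), cons_comp_swap]
    have hsw : ∀ (a b : Fin N) (f : Fin m → Fin N),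
        T (Fin.cons a (Fin.cons b f)) = - T (Fin.cons b (Fin.cons a f)) := by
      intro a b f
      rw [← hT _ 0 1 (by simp), cons_swap01]
    have h1 : ∑ f, T f • d (Pmon ξ f * x)
        = ∑ a, ∑ f : Fin (m + 1) → Fin N, T (Fin.cons a f) • (Pmon ξ f * (Dξ a * x))
          - ∑ a, ξ a * ∑ f : Fin (m + 1) → Fin N, T (Fin.cons a f) • d (Pmon ξ f * x) := by
      rw [sum_cons, ← Finset.sum_sub_distrib]
      refine Finset.sum_congr rfl fun a _ => ?_
      rw [Finset.mul_sum, ← Finset.sum_sub_distrib]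
      refine Finset.sum_congr rfl fun f _ => ?_
      rw [Pmon_cons, mul_assoc, hdLξ, smul_sub, mul_smul_comm,
        hDξc, mul_assoc, ← hDξc a x]
    have h2 : ∑ a, ξ a * (∑ b, ∑ f : Fin m → Fin N,
          T (Fin.cons a (Fin.cons b f)) • (Pmon ξ f * (Dξ b * x)))
        = - ∑ a, ∑ f : Fin (m + 1) → Fin N, T (Fin.cons a f) • (Pmon ξ f * (Dξ a * x)) := by
      simp only [Finset.mul_sum]
      rw [Finset.sum_comm, ← Finset.sum_neg_distrib]
      refine Finset.sum_congr rfl fun b _ => ?_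
      rw [sum_cons, ← Finset.sum_neg_distrib]
      refine Finset.sum_congr rfl fun a _ => ?_
      rw [← Finset.sum_neg_distrib]
      refine Finset.sum_congr rfl fun f _ => ?_
      rw [hsw a b, Pmon_cons, neg_smul, mul_neg, mul_smul_comm, mul_assoc]
    have h3 : ∑ f, T f • (Pmon ξ f * d x)
        = ∑ a, ξ a * ∑ f : Fin (m + 1) → Fin N, T (Fin.cons a f) • (Pmon ξ f * d x) := by
      rw [sum_cons]
      refine Finset.sum_congr rfl fun a _ => ?_
      rw [Finset.mul_sum]
      refine Finset.sum_congr rfl fun f _ => ?_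
      rw [Pmon_cons, mul_smul_comm, mul_assoc]
    rw [h1, h3]
    simp only [ih (fun f => T (Fin.cons _ f)) (hTa _), mul_add, mul_smul_comm,
      Finset.sum_add_distrib, ← Finset.smul_sum]
    rw [h2, pow_succ _ (m + 1)]
    push_cast
    module

theorem d_Vtwo {k : ℕ} {A : Type*} [Ring A] [Algebra ℝ A] (ξ Dξ : Fin (k + 3) → A)
    (hDξc : ∀ a x, Dξ a * x = x * Dξ a) (d : A →ₗ[ℝ] A)
    (hdLξ : ∀ a x, d (ξ a * x) = Dξ a * x - ξ a * d x) (b c : Fin (k + 3)) (x : A) :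
    d (Vtwo ξ b c * x) = ∑ a, Vthree ξ a b c * (Dξ a * x)
      + ((-1 : ℝ) ^ (k + 1)) • (Vtwo ξ b c * d x) := by
  have h := d_sum_Pmon ξ Dξ hDξc d hdLξ x k (fun f => eps (Fin.cons b (Fin.cons c f))) ?_
  · have hk : ((Nat.factorial k : ℝ))⁻¹ = ((Nat.factorial (k + 1) : ℝ))⁻¹ * ((k : ℝ) + 1) := by
      have h1 : (Nat.factorial k : ℝ) ≠ 0 := by exact_mod_cast Nat.factorial_ne_zero k
      have h2 : (k : ℝ) + 1 ≠ 0 := by positivity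
      rw [Nat.factorial_succ]
      push_cast
      field_simp
    have h3 : ∑ a, Vthree ξ a b c * (Dξ a * x) = ((Nat.factorial k : ℝ))⁻¹ •
        (∑ a, ∑ f : Fin k → Fin (k + 3),
          eps (Fin.cons b (Fin.cons c (Fin.cons a f))) • (Pmon ξ f * (Dξ a * x))) := by
      rw [Finset.smul_sum]
      refine Finset.sum_congr rfl fun a _ => ?_
      rw [Vthree_eq, smul_mul_assoc, Finset.sum_mul]
      congr 1
      refine Finset.sum_congr rfl fun f _ => ?_
      rw [smul_mul_assoc, eps_cons_swap01, eps_cons_swap12, neg_neg]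
    rw [h3, hk, Vtwo_eq, smul_mul_assoc, smul_mul_assoc, map_smul, Finset.sum_mul, map_sum,
      Finset.sum_mul]
    simp only [smul_mul_assoc, map_smul]
    rw [h, smul_add, mul_smul, smul_comm ((-1 : ℝ) ^ (k + 1))]
  · intro f i j hij
    show eps _ = - eps _
    rw [← eps_swap _ i.succ.succ j.succ.succ (by simpa using hij), cons_comp_swap,
      cons_comp_swap]

/-- a linear map commuting with left multiplication by the `ξ a` commutes with `Pmon` -/
theorem comm_Pmon {N m : ℕ} {A : Type*} [Ring A] [Algebra ℝ A] (ξ : Fin N → A)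
    (L : A →ₗ[ℝ] A) (hL : ∀ a x, L (ξ a * x) = ξ a * L x) (f : Fin m → Fin N) (x : A) :
    L (Pmon ξ f * x) = Pmon ξ f * L x := by
  induction m with
  | zero => simp [Pmon_zero]
  | succ m ih =>
    rw [← Fin.cons_self_tail f, Pmon_cons, mul_assoc, hL, ih, mul_assoc]

theorem comm_Vtwo {k : ℕ} {A : Type*} [Ring A] [Algebra ℝ A] (ξ : Fin (k + 3) → A)
    (L : A →ₗ[ℝ] A) (hL : ∀ a x, L (ξ a * x) = ξ a * L x) (a b : Fin (k + 3)) (x : A) :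
    L (Vtwo ξ a b * x) = Vtwo ξ a b * L x := by
  rw [Vtwo_eq]
  simp only [smul_mul_assoc, Finset.sum_mul, map_smul, map_sum, comm_Pmon ξ L hL]

theorem comm_Vthree {k : ℕ} {A : Type*} [Ring A] [Algebra ℝ A] (ξ : Fin (k + 3) → A)
    (L : A →ₗ[ℝ] A) (hL : ∀ a x, L (ξ a * x) = ξ a * L x) (a b c : Fin (k + 3)) (x : A) :
    L (Vthree ξ a b c * x) = Vthree ξ a b c * L x := by
  rw [Vthree_eq]
  simp only [smul_mul_assoc, Finset.sum_mul, map_smul, map_sum, comm_Pmon ξ L hL]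

theorem antisymm_sum_zero {N : ℕ} {A : Type*} [AddCommGroup A] [Module ℝ A]
    (F : Fin N → Fin N → A) (h : ∀ a b, F a b = - F b a) : ∑ a, ∑ b, F a b = 0 := by
  have h1 : ∑ a, ∑ b, F a b = - ∑ a, ∑ b, F a b := by
    conv_lhs => rw [Finset.sum_comm]
    simp only [← Finset.sum_neg_distrib]
    exact Finset.sum_congr rfl fun a _ => Finset.sum_congr rfl fun b _ => h b a
  have h2 : (2 : ℝ) • ∑ a, ∑ b, F a b = 0 := by
    rw [two_smul]; nth_rewrite 1 [h1]; simp
  exact (smul_eq_zero.mp h2).resolve_left (by norm_num)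


/-- the Lie derivative of `ω = 𝒱_{abc}(ξ) dξ^a ∧ dρ^{bc}` along
the Chevalley-Eilenberg vector field `q` vanishes: `L_q ω = 0`, where
`L_q = ι_q d + d ι_q` (Cartan formula).  The de Rham complex of `g[1]` is
modelled as in Statement 2; `ι` is the contraction with `q`. -/
theorem Lie_derivative_of_omega_vanishes
    (n : ℕ) (hn : 3 ≤ n) (lam : ℝ) (A : Type*) [Ring A] [Algebra ℝ A]
    (η : Fin n → Fin n → ℝ) (hη : ∀ a b, η a b = η b a)
    (ξ : Fin n → A) (ρ : Fin n → Fin n → A)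
    (Dξ : Fin n → A) (Dρ : Fin n → Fin n → A)
    (hρa : ∀ a b, ρ a b = - ρ b a)
    (hDρa : ∀ a b, Dρ a b = - Dρ b a)
    (hξξ : ∀ a b, ξ a * ξ b = - (ξ b * ξ a))
    (hξρ : ∀ a b c, ξ a * ρ b c = - (ρ b c * ξ a))
    (hρρ : ∀ a b c d, ρ a b * ρ c d = - (ρ c d * ρ a b))
    (hDξc : ∀ a x, Dξ a * x = x * Dξ a)
    (hDρc : ∀ a b x, Dρ a b * x = x * Dρ a b)
    -- the de Rham differential
    (d : A →ₗ[ℝ] A)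
    (hdξ : ∀ a, d (ξ a) = Dξ a)
    (hdρ : ∀ a b, d (ρ a b) = Dρ a b)
    (hdDξ : ∀ a, d (Dξ a) = 0)
    (hdDρ : ∀ a b, d (Dρ a b) = 0)
    (hdLξ : ∀ a x, d (ξ a * x) = Dξ a * x - ξ a * d x)
    (hdLρ : ∀ a b x, d (ρ a b * x) = Dρ a b * x - ρ a b * d x)
    (hdLDξ : ∀ a x, d (Dξ a * x) = Dξ a * d x)
    (hdLDρ : ∀ a b x, d (Dρ a b * x) = Dρ a b * d x)
    -- the components of the CE vector field `q`
    (qξ : Fin n → A) (qρ : Fin n → Fin n → A)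
    (hqξ : ∀ a, qξ a = ∑ b, ∑ c, η c b • (ρ a c * ξ b))
    (hqρ : ∀ a b, qρ a b =
      (∑ c, ∑ d, η c d • (ρ a c * ρ d b)) + lam • (ξ a * ξ b))
    -- the contraction `ι_q`: an even derivation killing the coordinates and
    -- replacing differentials by the components of `q`
    (ι : A →ₗ[ℝ] A)
    (hιξ : ∀ a, ι (ξ a) = 0)
    (hιρ : ∀ a b, ι (ρ a b) = 0)
    (hιDξ : ∀ a, ι (Dξ a) = qξ a)
    (hιDρ : ∀ a b, ι (Dρ a b) = qρ a b)
    (hιLξ : ∀ a x, ι (ξ a * x) = ξ a * ι x)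
    (hιLρ : ∀ a b x, ι (ρ a b * x) = ρ a b * ι x)
    (hιLDξ : ∀ a x, ι (Dξ a * x) = qξ a * x + Dξ a * ι x)
    (hιLDρ : ∀ a b x, ι (Dρ a b * x) = qρ a b * x + Dρ a b * ι x) :
    ι (d (∑ a, ∑ b, ∑ c, Vthree ξ a b c * (Dξ a * Dρ b c)))
      + d (ι (∑ a, ∑ b, ∑ c, Vthree ξ a b c * (Dξ a * Dρ b c))) = 0 := by
  
  obtain ⟨k, rfl⟩ : ∃ k, n = k + 3 := ⟨n - 3, by omega⟩
  -- abstract properties of the two volume tensors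
  obtain ⟨s, hs⟩ : ∃ s : ℝ, s = (-1 : ℝ) ^ (k + 1) := ⟨_, rfl⟩
  have hddξ : ∀ a x, d (d (ξ a * x)) = ξ a * d (d x) := by
    intro a x
    rw [hdLξ, map_sub, hdLDξ, hdLξ]
    abel
  have hddρ : ∀ a b x, d (d (ρ a b * x)) = ρ a b * d (d x) := by
    intro a b x
    rw [hdLρ, map_sub, hdLDρ, hdLρ]
    abel
  have hA : ∀ b c x, d (Vtwo ξ b c * x)
      = ∑ a, Vthree ξ a b c * (Dξ a * x) + s • (Vtwo ξ b c * d x) := by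
    intro b c x
    rw [hs]
    exact d_Vtwo ξ Dξ hDξc d hdLξ b c x
  have hdd2 : ∀ b c x, d (d (Vtwo ξ b c * x)) = Vtwo ξ b c * d (d x) := fun b c x =>
    comm_Vtwo ξ (d.comp d) hddξ b c x
  have hι3 : ∀ a b c x, ι (Vthree ξ a b c * x) = Vthree ξ a b c * ι x :=
    comm_Vthree ξ ι hιLξ
  have hB : ∀ a b c e, Vthree ξ a b c * ξ e = -(s • ((if a = e then (1 : ℝ) else 0) • Vtwo ξ b c
      - (if b = e then (1 : ℝ) else 0) • Vtwo ξ a c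
      + (if c = e then (1 : ℝ) else 0) • Vtwo ξ a b)) := by
    intro a b c e
    rw [← xi_mul_Vthree ξ hξξ, Vthree_mul_xi ξ hξξ, hs, pow_succ]
    simp
  have hV2 : ∀ a b, Vtwo ξ a b = - Vtwo ξ b a := Vtwo_swap ξ
  have hV3 : ∀ a b c, Vthree ξ a b c = - Vthree ξ c b a := by
    intro a b c
    rw [Vthree_swap01, Vthree_swap12, Vthree_swap01, neg_neg]
  -- d ω = 0
  have hdω : d (∑ a, ∑ b, ∑ c, Vthree ξ a b c * (Dξ a * Dρ b c)) = 0 := by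
    have : ∑ a, ∑ b, ∑ c, Vthree ξ a b c * (Dξ a * Dρ b c)
        = ∑ b, ∑ c, d (Vtwo ξ b c * Dρ b c) := by
      rw [Finset.sum_comm]
      refine Finset.sum_congr rfl fun b _ => ?_
      rw [Finset.sum_comm]
      refine Finset.sum_congr rfl fun c _ => ?_
      rw [hA, hdDρ]
      simp
    rw [this]
    simp [map_sum, hdd2, hdDρ]
  -- names for the pieces
  obtain ⟨X, hX⟩ : ∃ X, X = ∑ b, ∑ c, ∑ e, ∑ f, η e f • (Vtwo ξ b c * (ρ b e * Dρ f c)) :=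
    ⟨_, rfl⟩
  obtain ⟨Z, hZ⟩ : ∃ Z, Z = ∑ b, ∑ c, Vtwo ξ b c * (ξ b * Dξ c) := ⟨_, rfl⟩
  have hterm : ∀ a b c, Vthree ξ a b c * (qξ a * Dρ b c)
      = s • (∑ e, η e a • (Vtwo ξ b c * (ρ a e * Dρ b c))
        - ∑ e, η e b • (Vtwo ξ a c * (ρ a e * Dρ b c))
        + ∑ e, η e c • (Vtwo ξ a b * (ρ a e * Dρ b c))) := by
    intro a b c
    have h1 : ∀ e f, Vthree ξ a b c * (ρ a e * ξ f * Dρ b c)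
        = s • (((if a = f then (1 : ℝ) else 0) • Vtwo ξ b c
      - (if b = f then (1 : ℝ) else 0) • Vtwo ξ a c
      + (if c = f then (1 : ℝ) else 0) • Vtwo ξ a b) * (ρ a e * Dρ b c)) := by
      intro e f
      have : ρ a e * ξ f = - (ξ f * ρ a e) := by rw [hξρ, neg_neg]
      rw [this, neg_mul, mul_neg, mul_assoc, ← mul_assoc, hB, neg_mul, neg_neg, smul_mul_assoc]
    rw [hqξ, Finset.sum_mul, Finset.mul_sum]
    simp only [Finset.sum_mul, Finset.mul_sum, smul_mul_assoc, mul_smul_comm, h1]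
    rw [Finset.sum_comm, ← Finset.sum_sub_distrib, ← Finset.sum_add_distrib, Finset.smul_sum]
    refine Finset.sum_congr rfl fun e _ => ?_
    simp only [smul_comm _ s, ← Finset.smul_sum]
    congr 1
    simp only [sub_mul, add_mul, smul_add, smul_sub, ite_smul, one_smul, zero_smul, ite_mul,
      zero_mul, smul_ite, smul_zero, Finset.sum_add_distrib, Finset.sum_sub_distrib,
      Finset.sum_ite_eq, Finset.mem_univ, if_true]
  have hF1 : ∑ a, ∑ b, ∑ c, Vthree ξ a b c * (qξ a * Dρ b c) = (-(2 * s)) • X := by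
    have t1 : ∑ a, ∑ b, ∑ c, ∑ e, η e a • (Vtwo ξ b c * (ρ a e * Dρ b c)) = 0 := by
      rw [Finset.sum_comm]
      refine Finset.sum_eq_zero fun b _ => ?_
      rw [Finset.sum_comm]
      refine Finset.sum_eq_zero fun c _ => ?_
      refine antisymm_sum_zero _ fun a e => ?_
      rw [hη e a, hρa a e]
      simp
    have t2 : ∑ a, ∑ b, ∑ c, ∑ e, η e b • (Vtwo ξ a c * (ρ a e * Dρ b c)) = X := by
      rw [hX]
      refine Finset.sum_congr rfl fun a _ => ?_
      rw [Finset.sum_comm]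
      refine Finset.sum_congr rfl fun c _ => ?_
      rw [Finset.sum_comm]
    have t3 : ∑ a, ∑ b, ∑ c, ∑ e, η e c • (Vtwo ξ a b * (ρ a e * Dρ b c)) = - X := by
      rw [hX]
      simp only [← Finset.sum_neg_distrib]
      refine Finset.sum_congr rfl fun a _ => ?_
      refine Finset.sum_congr rfl fun b _ => ?_
      rw [Finset.sum_comm]
      refine Finset.sum_congr rfl fun e _ => ?_
      refine Finset.sum_congr rfl fun c _ => ?_
      rw [hDρa b c]
      simp
    simp only [hterm, ← Finset.smul_sum, Finset.sum_add_distrib, Finset.sum_sub_distrib]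
    rw [t1, t2, t3]
    module
  have hdq : ∀ b c, d (qρ b c)
      = (∑ e, ∑ f, η e f • (Dρ b e * ρ f c - ρ b e * Dρ f c))
        + lam • (Dξ b * ξ c - ξ b * Dξ c) := by
    intro b c
    simp only [hqρ, map_add, map_sum, map_smul, hdLρ, hdLξ, hdρ, hdξ]
  have hddq : ∀ b c, d (d (qρ b c)) = 0 := by
    intro b c
    simp [hqρ, map_add, map_sum, map_smul, hddρ, hddξ, hdρ, hdξ, hdDρ, hdDξ]
  have hY : ∑ b, ∑ c, Vtwo ξ b c * d (qρ b c) = (-2 : ℝ) • X + (-2 * lam) • Z := by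
    have y1 : ∑ b, ∑ c, ∑ e, ∑ f, η e f • (Vtwo ξ b c * (Dρ b e * ρ f c)) = - X := by
      rw [Finset.sum_comm, hX]
      simp only [← Finset.sum_neg_distrib]
      refine Finset.sum_congr rfl fun b _ => ?_
      refine Finset.sum_congr rfl fun c _ => ?_
      rw [Finset.sum_comm]
      refine Finset.sum_congr rfl fun e _ => ?_
      refine Finset.sum_congr rfl fun f _ => ?_
      rw [hη f e, hV2 c b, hDρa c f, hρa e b, neg_mul_neg, hDρc, neg_mul, smul_neg]
    have y2 : ∑ b, ∑ c, Vtwo ξ b c * (Dξ b * ξ c) = - Z := by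
      rw [Finset.sum_comm, hZ]
      simp only [← Finset.sum_neg_distrib]
      refine Finset.sum_congr rfl fun b _ => ?_
      refine Finset.sum_congr rfl fun c _ => ?_
      rw [hV2 c b, hDξc, neg_mul]
    simp only [hdq, mul_add, mul_sub, Finset.mul_sum, mul_smul_comm, smul_sub,
      Finset.sum_add_distrib, Finset.sum_sub_distrib, ← Finset.smul_sum]
    simp only [Finset.smul_sum] at y1 hX ⊢
    rw [y1, ← hX]
    simp only [← Finset.smul_sum]
    rw [y2, ← hZ]
    module
  have hF2 : ∑ a, ∑ b, ∑ c, Vthree ξ a b c * (Dξ a * qρ b c)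
      = ∑ b, ∑ c, d (Vtwo ξ b c * qρ b c) - s • ∑ b, ∑ c, Vtwo ξ b c * d (qρ b c) := by
    rw [Finset.sum_comm, Finset.smul_sum, ← Finset.sum_sub_distrib]
    refine Finset.sum_congr rfl fun b _ => ?_
    rw [Finset.sum_comm, Finset.smul_sum, ← Finset.sum_sub_distrib]
    refine Finset.sum_congr rfl fun c _ => ?_
    rw [hA, add_sub_cancel_right]
  have hιω : ι (∑ a, ∑ b, ∑ c, Vthree ξ a b c * (Dξ a * Dρ b c))
      = ∑ b, ∑ c, d (Vtwo ξ b c * qρ b c) + (2 * s * lam) • Z := by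
    simp only [map_sum, hι3, hιLDξ, hιDρ, mul_add, Finset.sum_add_distrib]
    rw [hF1, hF2, hY]
    module
  have hdZ : d Z = 0 := by
    have z1 : ∑ b, ∑ c, ∑ a, Vthree ξ a b c * (Dξ a * (ξ b * Dξ c)) = 0 := by
      refine Finset.sum_eq_zero fun b _ => ?_
      refine antisymm_sum_zero _ fun c a => ?_
      rw [hV3 a b c, neg_mul, hDξc a, ← hDξc c, mul_assoc]
    have z2 : ∑ b, ∑ c, Vtwo ξ b c * (Dξ b * Dξ c) = 0 := by
      refine antisymm_sum_zero _ fun b c => ?_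
      rw [hV2 b c, neg_mul, hDξc b]
    rw [hZ]
    simp only [map_sum, hA, hdLξ, hdDξ, mul_zero, sub_zero, Finset.sum_add_distrib,
      ← Finset.smul_sum]
    rw [z1, z2]
    simp
  rw [hdω, hιω]
  simp [map_sum, hdd2, hddq, hdZ]
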